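/- For every positive integer n, a set α_n ⊆ S_n with 1 ≤ card(α_n) ≤ n is an optimal set of n-points for P if and only if U_n(α_n) is an optimal set of n-means for P. -/

import Mathlib

open MeasureTheory

noncomputable section

/-- The Euclidean plane ℝ². -/
abbrev Plane : Type := EuclideanSpace ℝ (Fin 2)

/-- The point (x, y) in the Euclidean plane. -/
def pt (x y : ℝ) : Plane := (WithLp.equiv 2 (Fin 2 → ℝ)).symm ![x, y]

/-- P: the uniform probability measure on the segment J = [0,1] × {0}, i.e. the pushforward
of Lebesgue measure restricted to [0,1] under x ↦ (x, 0). -/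
def P : Measure Plane :=
  Measure.map (fun x : ℝ => pt x 0) (volume.restrict (Set.Icc (0 : ℝ) 1))

/-- The constraint S_j = {(x, x + 1/j) : -1/j ≤ x ≤ 1}. -/
def S (j : ℕ) : Set Plane :=
  {p | ∃ x : ℝ, -(1 / (j : ℝ)) ≤ x ∧ x ≤ 1 ∧ p = pt x (x + 1 / (j : ℝ))}

/-- min_{b ∈ β} ‖y - b‖², written as an infimum over the image set. -/
def minDist (β : Set Plane) (y : Plane) : ℝ :=
  sInf ((fun b => ‖y - b‖ ^ 2) '' β)

/-- The distortion error ∫ min_{b ∈ β} ‖y - b‖² dP(y) of a set β. -/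
def distortion (β : Set Plane) : ℝ := ∫ y, minDist β y ∂P

/-- The n-th constrained quantization error for P with respect to the family (S_j). -/
def Vn (n : ℕ) : ℝ :=
  sInf {v : ℝ | ∃ α : Finset Plane,
    ↑α ⊆ (⋃ j ∈ Finset.Icc 1 n, S j) ∧ 1 ≤ α.card ∧ α.card ≤ n ∧ v = distortion ↑α}

/-- α is an optimal set of n-points for P: α ⊆ ⋃_{j=1}^n S_j, 1 ≤ card α ≤ n, and α attains the
n-th constrained quantization error. -/
def IsOptimalNPoints (n : ℕ) (α : Finset Plane) : Prop :=
  ↑α ⊆ (⋃ j ∈ Finset.Icc 1 n, S j) ∧ 1 ≤ α.card ∧ α.card ≤ n ∧ distortion ↑α = Vn n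

/-- The map U_n, which on S_n sends (x, x + 1/n) to (2x + 1/n, 0). -/
def U (n : ℕ) (p : Plane) : Plane := pt (2 * p 0 + 1 / (n : ℝ)) 0

/-- β is an optimal set of n-means for P: 1 ≤ card β ≤ n and β minimizes the unconstrained
distortion error among all subsets of ℝ² of cardinality at most n. -/
def IsOptimalNMeans (n : ℕ) (β : Finset Plane) : Prop :=
  1 ≤ β.card ∧ β.card ≤ n ∧
    ∀ γ : Finset Plane, 1 ≤ γ.card → γ.card ≤ n → distortion ↑β ≤ distortion ↑γ

/-- The distance from `(t, 0)` to a point of the plane, in coordinates. -/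
lemma norm_pt_sub_sq (t : ℝ) (p : Plane) : ‖pt t 0 - p‖ ^ 2 = (t - p 0) ^ 2 + p 1 ^ 2 := by
  rw [EuclideanSpace.norm_sq_eq]
  simp [pt, Fin.sum_univ_two]

lemma pt_zero (x y : ℝ) : pt x y 0 = x := by simp [pt]

lemma pt_one (x y : ℝ) : pt x y 1 = y := by simp [pt]

lemma minDist_eq_inf' (β : Finset Plane) (hβ : β.Nonempty) (y : Plane) :
    minDist β y = β.inf' hβ fun b => ‖y - b‖ ^ 2 := by
  rw [Finset.inf'_eq_csInf_image]
  rfl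

lemma continuous_pt_zero : Continuous fun t : ℝ => pt t 0 := by
  refine (PiLp.continuous_toLp 2 (fun _ : Fin 2 => ℝ)).comp ?_
  refine continuous_pi fun i => ?_
  fin_cases i
  · exact continuous_id
  · exact continuous_const

lemma continuous_minDist (β : Finset Plane) (hβ : β.Nonempty) :
    Continuous (minDist (β : Set Plane)) := by
  simp_rw [funext (minDist_eq_inf' β hβ)]
  exact Continuous.finset_inf'_apply hβ fun b _ => by fun_prop

lemma distortion_eq_setIntegral (β : Finset Plane) (hβ : β.Nonempty) :
    distortion β = ∫ t in Set.Icc (0 : ℝ) 1, minDist β (pt t 0) :=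
  integral_map continuous_pt_zero.aemeasurable (continuous_minDist β hβ).aestronglyMeasurable

lemma distortion_nonneg (β : Set Plane) : 0 ≤ distortion β := by
  refine integral_nonneg fun y => Real.sInf_nonneg ?_
  rintro _ ⟨b, -, rfl⟩
  positivity

/-- An affine comparison of squared distances on the segment integrates to an affine comparison
of distortions. -/
lemma mul_distortion_add_le {α β : Finset Plane} (hα : α.Nonempty) (hβ : β.Nonempty) {k : ℝ}
    (hk : 0 ≤ k) {g : ℝ → ℝ} (hg : Continuous g)
    (h : ∀ t ∈ Set.Icc (0 : ℝ) 1, ∀ a ∈ α, ∃ b ∈ β,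
      k * ‖pt t 0 - b‖ ^ 2 + g t ≤ ‖pt t 0 - a‖ ^ 2) :
    k * distortion β + ∫ t in Set.Icc (0 : ℝ) 1, g t ≤ distortion α := by
  have hc (γ : Finset Plane) (hγ : γ.Nonempty) : Continuous fun t : ℝ => minDist γ (pt t 0) :=
    (continuous_minDist γ hγ).comp continuous_pt_zero
  have hi {f : ℝ → ℝ} (hf : Continuous f) : IntegrableOn f (Set.Icc 0 1) :=
    hf.continuousOn.integrableOn_compact isCompact_Icc
  rw [distortion_eq_setIntegral α hα, distortion_eq_setIntegral β hβ, ← integral_const_mul,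
    ← integral_add ((hi (hc β hβ)).const_mul k) (hi hg)]
  refine setIntegral_mono_on (hi (((hc β hβ).const_mul k).add hg)) (hi (hc α hα))
    measurableSet_Icc fun t ht => ?_
  rw [minDist_eq_inf' α hα, minDist_eq_inf' β hβ, Finset.le_inf'_iff]
  intro a ha
  obtain ⟨b, hb, hab⟩ := h t ht a ha
  have := mul_le_mul_of_nonneg_left (Finset.inf'_le (fun b => ‖pt t 0 - b‖ ^ 2) hb) hk
  linarith

/-- The inverse of `U n` applied to the point of `J` nearest to `p`. -/
def liftToS (n : ℕ) (p : Plane) : Plane :=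
  pt ((max 0 (min 1 (p 0)) - 1 / (n : ℝ)) / 2)
    ((max 0 (min 1 (p 0)) - 1 / (n : ℝ)) / 2 + 1 / (n : ℝ))

lemma liftToS_mem_S (n : ℕ) (p : Plane) : liftToS n p ∈ S n := by
  have hn : (0 : ℝ) ≤ 1 / n := by positivity
  have h₀ : 0 ≤ max 0 (min 1 (p 0)) := le_max_left _ _
  have h₁ : max 0 (min 1 (p 0)) ≤ 1 := max_le zero_le_one (min_le_left _ _)
  exact ⟨_, by linarith, by linarith, rfl⟩

lemma sq_sub_clamp_le {t : ℝ} (ht : t ∈ Set.Icc (0 : ℝ) 1) (x : ℝ) :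
    (t - max 0 (min 1 x)) ^ 2 ≤ (t - x) ^ 2 := by
  obtain ⟨h₀, h₁⟩ := ht
  rcases le_total 1 x with hx | hx
  · rw [min_eq_left hx, max_eq_right zero_le_one]
    nlinarith
  · rw [min_eq_right hx]
    rcases le_total 0 x with hx' | hx'
    · rw [max_eq_right hx']
    · rw [max_eq_left hx']
      nlinarith

open Classical in
lemma two_mul_distortion_liftToS_le (n : ℕ) {γ : Finset Plane} (hγ : γ.Nonempty) :
    2 * distortion (γ.image (liftToS n)) + ∫ t in Set.Icc (0 : ℝ) 1, -(t + 1 / (n : ℝ)) ^ 2 ≤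
      distortion γ := by
  refine mul_distortion_add_le hγ (hγ.image _) zero_le_two (by fun_prop) fun t ht a ha =>
    ⟨_, Finset.mem_image_of_mem _ ha, ?_⟩
  have h := sq_sub_clamp_le ht (a 0)
  rw [norm_pt_sub_sq, norm_pt_sub_sq, liftToS, pt_zero, pt_one]
  nlinarith [sq_nonneg (a 1)]

open Classical in
lemma two_mul_distortion_le_of_subset_S {n : ℕ} {α : Finset Plane} (hα : α.Nonempty)
    (hsub : ↑α ⊆ S n) :
    2 * distortion α + ∫ t in Set.Icc (0 : ℝ) 1, -(t + 1 / (n : ℝ)) ^ 2 ≤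
      distortion (α.image (U n)) := by
  refine mul_distortion_add_le (hα.image _) hα zero_le_two (by fun_prop) fun t _ b hb => ?_
  obtain ⟨a, ha, rfl⟩ := Finset.mem_image.1 hb
  refine ⟨a, ha, ?_⟩
  obtain ⟨x, -, -, rfl⟩ := hsub ha
  rw [norm_pt_sub_sq, norm_pt_sub_sq, U, pt_zero, pt_one, pt_zero, pt_one]
  linarith

open Classical in
/-- For points of any of the constraints `S 1, …, S n`, replacing `(x, y)` by `(x + y, 0)` gives
a set of means whose distortion bounds that of the original set from below. -/
lemma half_mul_distortion_image_le {n : ℕ} {α : Finset Plane} (hα : α.Nonempty)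
    (hsub : ↑α ⊆ ⋃ j ∈ Finset.Icc 1 n, S j) :
    1 / 2 * distortion (α.image fun p => pt (p 0 + p 1) 0) +
      ∫ t in Set.Icc (0 : ℝ) 1, 1 / 2 * (t + 1 / (n : ℝ)) ^ 2 ≤ distortion α := by
  refine mul_distortion_add_le hα (hα.image _) (by norm_num) (by fun_prop) fun t ht a ha =>
    ⟨_, Finset.mem_image_of_mem _ ha, ?_⟩
  obtain ⟨j, hj, x, -, -, rfl⟩ := Set.mem_iUnion₂.1 (hsub ha)
  obtain ⟨hj₁, hjn⟩ := Finset.mem_Icc.1 hj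
  have hj₀ : (0 : ℝ) < j := by exact_mod_cast hj₁
  have hle : 1 / (n : ℝ) ≤ 1 / (j : ℝ) :=
    one_div_le_one_div_of_le hj₀ (by exact_mod_cast hjn)
  have hsq : (t + 1 / (n : ℝ)) ^ 2 ≤ (t + 1 / (j : ℝ)) ^ 2 :=
    pow_le_pow_left₀ (add_nonneg ht.1 (by positivity)) (by linarith) 2
  simp only [norm_pt_sub_sq, pt_zero, pt_one]
  linarith

lemma S_subset_iUnion {n : ℕ} (hn : 1 ≤ n) : S n ⊆ ⋃ j ∈ Finset.Icc 1 n, S j :=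
  Set.subset_biUnion_of_mem (u := S) (Finset.mem_coe.2 (Finset.mem_Icc.2 ⟨hn, le_rfl⟩))

lemma U_eq_of_mem_S {n : ℕ} {p : Plane} (hp : p ∈ S n) : U n p = pt (p 0 + p 1) 0 := by
  obtain ⟨x, -, -, rfl⟩ := hp
  rw [U, pt_zero, pt_one]
  ring_nf

/-- a set α_n ⊆ S_n with 1 ≤ card(α_n) ≤ n is an optimal set of n-points for P
if and only if U_n(α_n) is an optimal set of n-means for P. -/
theorem optimal_points_iff_optimal_means (n : ℕ) (hn : 1 ≤ n) (α : Finset Plane)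
    (hsub : ↑α ⊆ S n) (hcard₁ : 1 ≤ α.card) (hcard₂ : α.card ≤ n) :
    letI : DecidableEq Plane := Classical.decEq _
    (IsOptimalNPoints n α ↔ IsOptimalNMeans n (α.image (U n))) := by
  classical
  have hα : α.Nonempty := Finset.card_pos.1 hcard₁
  have hneg := integral_neg (μ := volume.restrict (Set.Icc (0 : ℝ) 1))
    fun t : ℝ => (t + 1 / (n : ℝ)) ^ 2
  have hhalf := integral_const_mul (μ := volume.restrict (Set.Icc (0 : ℝ) 1)) (1 / 2 : ℝ)
    fun t : ℝ => (t + 1 / (n : ℝ)) ^ 2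
  have hU : α.image (U n) = α.image fun p => pt (p 0 + p 1) 0 :=
    Finset.image_congr fun p hp => U_eq_of_mem_S (hsub hp)
  have himage : 1 ≤ (α.image (U n)).card ∧ (α.image (U n)).card ≤ n :=
    ⟨Finset.card_pos.2 (hα.image _), Finset.card_image_le.trans hcard₂⟩
  have hunion := hsub.trans (S_subset_iUnion hn)
  have hlower := half_mul_distortion_image_le hα hunion
  have hupper := two_mul_distortion_le_of_subset_S hα hsub
  constructor
  · rintro ⟨-, -, -, hopt⟩
    refine ⟨?_, ?_, fun γ hγ₁ hγ₂ => ?_⟩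
    · convert himage.1
    · convert himage.2
    have hγ : γ.Nonempty := Finset.card_pos.1 hγ₁
    have hlift := two_mul_distortion_liftToS_le n hγ
    have hVn : Vn n ≤ distortion (γ.image (liftToS n)) := by
      refine csInf_le ⟨0, ?_⟩ ⟨_, ?_, Finset.card_pos.2 (hγ.image _),
        Finset.card_image_le.trans hγ₂, rfl⟩
      · rintro _ ⟨δ, -, -, -, rfl⟩
        exact distortion_nonneg _
      · intro p hp
        obtain ⟨q, -, rfl⟩ := Finset.mem_image.1 hp
        exact S_subset_iUnion hn (liftToS_mem_S n q)
    rw [← hU] at hlower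
    have : distortion (α.image (U n)) ≤ distortion γ := by linarith
    convert this
  · rintro ⟨-, -, hopt⟩
    refine ⟨hunion, hcard₁, hcard₂, le_antisymm ?_ ?_⟩
    · refine le_csInf ⟨_, α, hunion, hcard₁, hcard₂, rfl⟩ ?_
      rintro _ ⟨δ, hδ, hδ₁, hδ₂, rfl⟩
      have hδ' : δ.Nonempty := Finset.card_pos.1 hδ₁
      have h₁ := half_mul_distortion_image_le hδ' hδ
      have h₂ : distortion (α.image (U n)) ≤ distortion (δ.image fun p => pt (p 0 + p 1) 0) := by
        convert hopt _ (Finset.card_pos.2 (hδ'.image _)) (Finset.card_image_le.trans hδ₂)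
      linarith
    · refine csInf_le ⟨0, ?_⟩ ⟨α, hunion, hcard₁, hcard₂, rfl⟩
      rintro _ ⟨δ, -, -, -, rfl⟩
      exact distortion_nonneg _

end
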